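/- Let W be an N×N real row-stochastic matrix and let π ∈ ℝ^N be a probability vector with strictly positive entries satisfying πᵀ W = πᵀ. Let Π = diag(π), and suppose Π^{1/2} W Π^{−1/2} = M Σ Nᵀ, where Σ is an N×N diagonal matrix and N is an N×N matrix with orthonormal columns (Nᵀ N = I). Define the map Ψ by Ψ(i) = e_iᵀ Π^{−1/2} M Σ (the i-th row of Π^{−1/2} M Σ). Then for all indices i, j: Σ_{k=1}^{N} (1/π(k)) (W_{ik} − W_{jk})² = ‖Ψ(i) − Ψ(j)‖₂². -/

import Mathlib

open Matrix BigOperators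

/-- A square real matrix is row-stochastic if all entries are nonnegative and
every row sums to `1`. -/
def RowStochastic {n : ℕ} (A : Matrix (Fin n) (Fin n) ℝ) : Prop :=
  (∀ i j, 0 ≤ A i j) ∧ ∀ i, ∑ j, A i j = 1

/-- Right multiplication by the transpose of a matrix with orthonormal columns preserves the
sum of squares of a row vector. -/
theorem dotProduct_vecMul_transpose_self {m n : Type*} [Fintype m] [Fintype n] [DecidableEq n]
    {Q : Matrix m n ℝ} (hQ : Qᵀ * Q = 1) (v : n → ℝ) :
    (v ᵥ* Qᵀ) ⬝ᵥ (v ᵥ* Qᵀ) = v ⬝ᵥ v := by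
  rw [Matrix.vecMul_transpose, Matrix.dotProduct_mulVec, Matrix.vecMul_mulVec, hQ,
    Matrix.vecMul_one]

/-- **Diffusion distance preservation.** Let `W` be row-stochastic with strictly
positive stationary distribution `π`, `Π = diag π`, and let
`Π^{1/2} W Π^{-1/2} = M Σ Nᵀ` with `Σ` diagonal and `N` having orthonormal columns
(`Nᵀ N = I`).  Then the diffusion map `Ψ(i) = eᵢᵀ Π^{-1/2} M Σ` (the `i`-th row of
`Π^{-1/2} M Σ`) is an isometry for the diffusion distance:
`Σ_k (1/π k) (W i k − W j k)² = ‖Ψ(i) − Ψ(j)‖₂²`. -/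
theorem diffusion_distance_preservation {n : ℕ}
    (W : Matrix (Fin n) (Fin n) ℝ) (π : Fin n → ℝ)
    (hW : RowStochastic W)
    (hπpos : ∀ k, 0 < π k) (hπsum : ∑ k, π k = 1)
    (hstat : π ᵥ* W = π)
    (M S Nm : Matrix (Fin n) (Fin n) ℝ)
    (hSdiag : ∀ i j, i ≠ j → S i j = 0)
    (hNorth : Nmᵀ * Nm = 1)
    (hSVD : (Matrix.diagonal fun k => Real.sqrt (π k)) * W *
        (Matrix.diagonal fun k => (Real.sqrt (π k))⁻¹) = M * S * Nmᵀ) :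
    ∀ i j : Fin n,
      (∑ k, (1 / π k) * (W i k - W j k) ^ 2) =
        ∑ k, (((Matrix.diagonal fun k => (Real.sqrt (π k))⁻¹) * M * S) i k -
              ((Matrix.diagonal fun k => (Real.sqrt (π k))⁻¹) * M * S) j k) ^ 2 := by
  intro i j
  set R : Matrix (Fin n) (Fin n) ℝ := Matrix.diagonal fun k => (Real.sqrt (π k))⁻¹ with hR
  have hinv : R * (Matrix.diagonal fun k => Real.sqrt (π k)) = 1 := by
    rw [hR, Matrix.diagonal_mul_diagonal, ← Matrix.diagonal_one]
    congr 1
    funext k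
    exact inv_mul_cancel₀ (Real.sqrt_pos.2 (hπpos k)).ne'
  have hfactor : W * R = R * M * S * Nmᵀ := by
    calc W * R = R * ((Matrix.diagonal fun k => Real.sqrt (π k)) * W * R) := by
          rw [← Matrix.mul_assoc, ← Matrix.mul_assoc, hinv, Matrix.one_mul]
      _ = R * M * S * Nmᵀ := by rw [hSVD]; simp only [Matrix.mul_assoc]
  have hrow : (W * R) i - (W * R) j = ((R * M * S) i - (R * M * S) j) ᵥ* Nmᵀ := by
    rw [hfactor, Matrix.sub_vecMul]
    rfl
  have hnorm := dotProduct_vecMul_transpose_self hNorth ((R * M * S) i - (R * M * S) j)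
  rw [← hrow] at hnorm
  simp only [dotProduct, Pi.sub_apply, ← sq] at hnorm
  rw [← hnorm]
  refine Finset.sum_congr rfl fun k _ => ?_
  rw [hR, Matrix.mul_diagonal, Matrix.mul_diagonal, ← sub_mul, mul_pow, inv_pow,
    Real.sq_sqrt (hπpos k).le, one_div, mul_comm]
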